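/- Assume condition (*). A graded A-module M belongs to O⁺ if and only if M has no graded subquotient isomorphic to A^{λ,−} for any maximal ideal λ of R. -/

import Mathlib

noncomputable section

/-- A realization of the generalized Weyl algebra `T(R,σ,v)`:
a `ℤ`-graded `ℂ`-algebra `A` containing `R` in degree `0`, with elements
`t₊` of degree `1` and `t₋` of degree `-1` satisfying the GWA relations, such that each
homogeneous component `A_n` is free of rank one as a left `R`-module with basis
`t₊^n` (for `n ≥ 0`) resp. `t₋^{-n}` (for `n ≤ 0`). -/
structure GWA (R : Type) [CommRing R] [Algebra ℂ R] (σ : R ≃ₐ[ℂ] R) (v : R) : Type 1 where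
  A : Type
  [ringA : Ring A]
  [algA : Algebra ℂ A]
  emb : R →ₐ[ℂ] A
  tp : A
  tm : A
  rel1 : ∀ r : R, emb r * tp = tp * emb (σ r)
  rel2 : ∀ r : R, emb (σ r) * tm = tm * emb r
  rel3 : tm * tp = emb (σ v)
  rel4 : tp * tm = emb v
  deg : ℤ → AddSubgroup A
  algmap_mem : ∀ c : ℂ, algebraMap ℂ A c ∈ deg 0
  emb_mem : ∀ r : R, emb r ∈ deg 0
  tp_mem : tp ∈ deg 1
  tm_mem : tm ∈ deg (-1)
  mul_mem : ∀ {i j : ℤ} {a b : A}, a ∈ deg i → b ∈ deg j → a * b ∈ deg (i + j)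
  decomp : ∀ a : A, ∃ (s : Finset ℤ) (g : ℤ → A), (∀ i, g i ∈ deg i) ∧ a = ∑ i ∈ s, g i
  indep : ∀ (s : Finset ℤ) (g : ℤ → A), (∀ i, g i ∈ deg i) → (∑ i ∈ s, g i) = 0 →
    ∀ i ∈ s, g i = 0
  free_pos : ∀ n : ℕ, ∀ a ∈ deg (n : ℤ), ∃! r : R, a = emb r * tp ^ n
  free_neg : ∀ n : ℕ, ∀ a ∈ deg (-(n : ℤ)), ∃! r : R, a = emb r * tm ^ n

attribute [instance] GWA.ringA GWA.algA

variable {R : Type} [CommRing R] [Algebra ℂ R] {σ : R ≃ₐ[ℂ] R} {v : R}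

/-- A `ℤ`-graded left module over (a realization of) a generalized Weyl algebra. -/
structure GradedMod (G : GWA R σ v) : Type 1 where
  M : Type
  [acg : AddCommGroup M]
  [mod : Module G.A M]
  deg : ℤ → AddSubgroup M
  smul_mem : ∀ {i j : ℤ} {a : G.A} {m : M}, a ∈ G.deg i → m ∈ deg j → a • m ∈ deg (i + j)
  decomp : ∀ m : M, ∃ (s : Finset ℤ) (g : ℤ → M), (∀ i, g i ∈ deg i) ∧ m = ∑ i ∈ s, g i
  indep : ∀ (s : Finset ℤ) (g : ℤ → M), (∀ i, g i ∈ deg i) → (∑ i ∈ s, g i) = 0 →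
    ∀ i ∈ s, g i = 0

attribute [instance] GradedMod.acg GradedMod.mod

variable {G : GWA R σ v}

/-- A homomorphism of graded modules that shifts degrees by `n`, i.e. an element of
`Hom_gr(X, Y[n])`. -/
structure GHom (X Y : GradedMod G) (n : ℤ) : Type where
  toLin : X.M →ₗ[G.A] Y.M
  map_deg : ∀ i : ℤ, ∀ m ∈ X.deg i, toLin m ∈ Y.deg (i + n)

/-- `X` is isomorphic to `Y[n]` as a graded module. -/
def GIso (X Y : GradedMod G) (n : ℤ) : Prop :=
  ∃ f : GHom X Y n, Function.Bijective f.toLin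

/-- A submodule is graded if every element of it is a sum of homogeneous elements of it. -/
def IsGradedSub (X : GradedMod G) (N : Submodule G.A X.M) : Prop :=
  ∀ m ∈ N, ∃ (s : Finset ℤ) (g : ℤ → X.M),
    (∀ i, g i ∈ X.deg i) ∧ (∀ i, g i ∈ N) ∧ m = ∑ i ∈ s, g i

/-- `χ_λ = {k ∈ ℤ : σ^k(v) ∈ λ}`. -/
def chiSet (σ : R ≃ₐ[ℂ] R) (v : R) (lam : Ideal R) : Set ℤ := {k : ℤ | (σ ^ k) v ∈ lam}

/-- `X` is (a realization of) the graded module `A^λ = A/Aλ`: it is cyclic, generated by a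
degree-zero element whose annihilator is the left ideal generated by `λ`. -/
def IsStdMod (G : GWA R σ v) (lam : Ideal R) (X : GradedMod G) : Prop :=
  ∃ x ∈ X.deg 0, Submodule.span G.A {x} = ⊤ ∧
    ∀ a : G.A, a • x = 0 ↔ a ∈ Submodule.span G.A (G.emb '' (lam : Set R))

/-- A graded module is simple if it is nonzero and has no proper nontrivial graded submodules. -/
def IsSimpleGr (X : GradedMod G) : Prop :=
  (∃ m : X.M, m ≠ 0) ∧ ∀ N : Submodule G.A X.M, IsGradedSub X N → N = ⊥ ∨ N = ⊤

/-- Artinian graded module : the descending chain condition on graded submodules. -/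
def IsArtinianGr (X : GradedMod G) : Prop :=
  ∀ f : ℕ → Submodule G.A X.M, (∀ n, IsGradedSub X (f n)) →
    (∀ n, f (n + 1) ≤ f n) → ∃ n, ∀ m, n ≤ m → f m = f n

/-- `Y` is a graded subquotient of `X`. -/
def IsSubquotient (X Y : GradedMod G) : Prop :=
  ∃ (Q P : Submodule G.A X.M), IsGradedSub X Q ∧ IsGradedSub X P ∧ P ≤ Q ∧
    ∃ φ : Q →ₗ[G.A] Y.M, Function.Surjective φ ∧
      (∀ q : Q, φ q = 0 ↔ (q : X.M) ∈ P) ∧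
      (∀ (i : ℤ) (q : Q), (q : X.M) ∈ X.deg i → φ q ∈ Y.deg i)

/-- A graded submodule, regarded as a graded module in its own right. -/
def SubGM (X : GradedMod G) (N : Submodule G.A X.M) (hN : IsGradedSub X N) : GradedMod G where
  M := ↥N
  deg i :=
    { carrier := {m : ↥N | (m : X.M) ∈ X.deg i}
      add_mem' := fun {a b} ha hb => by
        simp only [Set.mem_setOf_eq, Submodule.coe_add] at *
        exact add_mem ha hb
      zero_mem' := by simp only [Set.mem_setOf_eq, Submodule.coe_zero]; exact zero_mem _
      neg_mem' := fun {a} ha => by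
        simp only [Set.mem_setOf_eq, Submodule.coe_neg] at *
        exact neg_mem ha }
  smul_mem := by
    intro i j a m ha hm
    simp only [AddSubgroup.mem_mk, Set.mem_setOf_eq, Submodule.coe_smul] at *
    exact X.smul_mem ha hm
  decomp := by
    intro m
    obtain ⟨s, g, hgdeg, hgN, hsum⟩ := hN (m : X.M) m.2
    refine ⟨s, fun i => ⟨g i, hgN i⟩, fun i => hgdeg i, ?_⟩
    apply Subtype.ext
    rw [Submodule.coe_sum]
    exact hsum
  indep := by
    intro s g hg h0 i hi
    have h0' : (∑ j ∈ s, ((g j : X.M))) = 0 := by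
      rw [← Submodule.coe_sum, h0, Submodule.coe_zero]
    have := X.indep s (fun j => (g j : X.M)) (fun j => hg j) h0' i hi
    exact Subtype.ext this
/-- `M` belongs to `O⁺`: the action of `t₋` is locally nilpotent. -/
def InOPlus (G : GWA R σ v) (X : GradedMod G) : Prop :=
  ∀ m : X.M, ∃ k : ℕ, (G.tm ^ k) • m = 0
/-- The zero locus `Z = Spec R/(v) ⊆ Spec R`. -/
def ZLocus (R : Type) [CommRing R] (v : R) : Set (PrimeSpectrum R) :=
  PrimeSpectrum.zeroLocus {v}

/-- The action `Ξⁿ` of `σ` on `Spec R`: `Ξⁿ(p) = σ^{-n}(p)`, i.e. the comap of `σ^n`. -/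
def XiMap (σ : R ≃ₐ[ℂ] R) (n : ℤ) : PrimeSpectrum R → PrimeSpectrum R :=
  fun p => PrimeSpectrum.comap ((σ ^ n : R ≃ₐ[ℂ] R)).toAlgHom.toRingHom p

/-- `W` is a connected component of `Z`. -/
def IsCC (Z W : Set (PrimeSpectrum R)) : Prop :=
  ∃ x ∈ Z, W = connectedComponentIn Z x

/-- Condition (*): for every connected component `W` of `Z` and every `n`, `W ∩ Ξⁿ(Z)` is
empty or a connected component of `Z`, and it is empty for all sufficiently large `n`. -/
def StarCond (σ : R ≃ₐ[ℂ] R) (v : R) : Prop :=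
  ∀ W : Set (PrimeSpectrum R), IsCC (ZLocus R v) W →
    (∀ n : ℤ, W ∩ (XiMap σ n '' ZLocus R v) = ∅ ∨
      IsCC (ZLocus R v) (W ∩ (XiMap σ n '' ZLocus R v))) ∧
    ∃ N : ℤ, ∀ n : ℤ, N ≤ n → W ∩ (XiMap σ n '' ZLocus R v) = ∅

/-- The annihilator of a graded submodule `N ⊆ X` for the natural right `R`-module structure
(`m · r = σ^i(r) • m` on the degree-`i` component). -/
def rAnn (G : GWA R σ v) (X : GradedMod G) (N : Submodule G.A X.M) : Set R :=
  {r : R | ∀ i : ℤ, ∀ m ∈ N, m ∈ X.deg i → G.emb ((σ ^ i) r) • m = 0}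

/-- The support in `Spec R` of a graded submodule `N ⊆ X` as a right `R`-module. -/
def rsupp (G : GWA R σ v) (X : GradedMod G) (N : Submodule G.A X.M) :
    Set (PrimeSpectrum R) :=
  {p : PrimeSpectrum R | rAnn G X N ⊆ p.asIdeal}

/-- `X` is (a realization of) `A(n) = A/At₋ⁿ`: cyclic with a degree-zero generator whose
annihilator is the left ideal generated by `t₋ⁿ`. -/
def IsAn (G : GWA R σ v) (n : ℕ) (X : GradedMod G) : Prop :=
  ∃ x ∈ X.deg 0, Submodule.span G.A {x} = ⊤ ∧
    ∀ a : G.A, a • x = 0 ↔ a ∈ Submodule.span G.A {G.tm ^ n}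

/-- `Y` is (isomorphic to) the direct summand of `X` supported on `W`. -/
def IsWSummand (G : GWA R σ v) (X : GradedMod G) (W : Set (PrimeSpectrum R))
    (Y : GradedMod G) : Prop :=
  ∃ (D C : Submodule G.A X.M) (hD : IsGradedSub X D), IsGradedSub X C ∧
    D ⊓ C = ⊥ ∧ D ⊔ C = ⊤ ∧ rsupp G X D ⊆ W ∧ rsupp G X C ∩ W = ∅ ∧
    GIso (SubGM X D hD) Y 0

/-- `Y` is (a realization of) the projective object `P_W = A_W`: the stable value, for all
sufficiently large `n`, of the summand of `A(n)` supported on `W`. -/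
def IsPW (G : GWA R σ v) (W : Set (PrimeSpectrum R)) (Y : GradedMod G) : Prop :=
  ∃ N : ℕ, ∀ n : ℕ, N ≤ n → ∃ X : GradedMod G, IsAn G n X ∧ IsWSummand G X W Y
/-- `S` is (isomorphic to) `A^{λ,−}`: the unique simple graded subquotient of `A^λ` whose
degree support is unbounded below. -/
def IsALamMinus (G : GWA R σ v) (lam : Ideal R) (S : GradedMod G) : Prop :=
  ∃ X : GradedMod G, IsStdMod G lam X ∧ IsSubquotient X S ∧ IsSimpleGr S ∧
    ∀ N : ℤ, ∃ i : ℤ, i ≤ N ∧ S.deg i ≠ ⊥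

section Components

variable {B C : Type} [AddCommGroup B] [AddCommGroup C]

/-- The data making `B` a `ℤ`-graded abelian group. -/
structure IsGrd (D : ℤ → AddSubgroup B) : Prop where
  dec : ∀ a : B, ∃ (s : Finset ℤ) (g : ℤ → B), (∀ i, g i ∈ D i) ∧ a = ∑ i ∈ s, g i
  ind : ∀ (s : Finset ℤ) (g : ℤ → B), (∀ i, g i ∈ D i) → (∑ i ∈ s, g i) = 0 →
    ∀ i ∈ s, g i = 0

open Classical in
/-- Homogeneous component. -/
def cmpFun {D : ℤ → AddSubgroup B} (h : IsGrd D) (i : ℤ) (a : B) : B :=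
  if i ∈ (h.dec a).choose then (h.dec a).choose_spec.choose i else 0

theorem cmpFun_eq {D : ℤ → AddSubgroup B} (h : IsGrd D) (a : B) (t : Finset ℤ) (g : ℤ → B)
    (hg : ∀ i, g i ∈ D i) (ha : a = ∑ i ∈ t, g i) (i : ℤ) :
    cmpFun h i a = if i ∈ t then g i else 0 := by
  classical
  obtain ⟨h1, h2⟩ := (h.dec a).choose_spec.choose_spec
  set s := (h.dec a).choose with hs
  set f := (h.dec a).choose_spec.choose with hf
  have hc : cmpFun h i a = if i ∈ s then f i else 0 := by
    unfold cmpFun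
    congr
  rw [hc]
  have key := h.ind (s ∪ t) (fun j => (if j ∈ s then f j else 0) - (if j ∈ t then g j else 0))
    (by
      intro j
      apply sub_mem <;> split_ifs
      · exact h1 j
      · exact zero_mem _
      · exact hg j
      · exact zero_mem _)
    (by
      rw [Finset.sum_sub_distrib, Finset.sum_ite_mem, Finset.sum_ite_mem,
        Finset.union_inter_cancel_left, Finset.union_inter_cancel_right, ← h2, ← ha, sub_self])
  by_cases hi : i ∈ s ∪ t
  · exact sub_eq_zero.1 (key i hi)
  · rw [Finset.mem_union, not_or] at hi
    simp [hi.1, hi.2]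

theorem cmpFun_mem {D : ℤ → AddSubgroup B} (h : IsGrd D) (a : B) (i : ℤ) :
    cmpFun h i a ∈ D i := by
  unfold cmpFun
  split_ifs
  · exact (h.dec a).choose_spec.choose_spec.1 i
  · exact zero_mem _

theorem cmpFun_sum {D : ℤ → AddSubgroup B} (h : IsGrd D) (a : B) :
    ∃ s : Finset ℤ, (∀ i ∉ s, cmpFun h i a = 0) ∧ a = ∑ i ∈ s, cmpFun h i a := by
  obtain ⟨s, g, hg, ha⟩ := h.dec a
  refine ⟨s, ?_, ?_⟩
  · intro i hi
    rw [cmpFun_eq h a s g hg ha]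
    simp [hi]
  · conv_lhs => rw [ha]
    apply Finset.sum_congr rfl
    intro i hi
    rw [cmpFun_eq h a s g hg ha]
    simp [hi]

theorem cmpFun_eq' {D : ℤ → AddSubgroup B} (h : IsGrd D) (a : B) (t : Finset ℤ) (g : ℤ → B)
    (hg : ∀ i, g i ∈ D i) (h0 : ∀ i ∉ t, g i = 0) (ha : a = ∑ i ∈ t, g i) (i : ℤ) :
    cmpFun h i a = g i := by
  rw [cmpFun_eq h a t g hg ha]
  split_ifs with hi
  · rfl
  · exact (h0 i hi).symm

/-- Homogeneous component as an additive map. -/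
def hcmp {D : ℤ → AddSubgroup B} (h : IsGrd D) (i : ℤ) : B →+ B :=
  AddMonoidHom.mk' (cmpFun h i) (by
    classical
    intro a b
    obtain ⟨s, hs0, hs⟩ := cmpFun_sum h a
    obtain ⟨t, ht0, ht⟩ := cmpFun_sum h b
    refine cmpFun_eq' h _ (s ∪ t) (fun j => cmpFun h j a + cmpFun h j b) ?_ ?_ ?_ i
    · exact fun j => add_mem (cmpFun_mem h a j) (cmpFun_mem h b j)
    · intro j hj
      rw [Finset.mem_union, not_or] at hj
      simp [hs0 j hj.1, ht0 j hj.2]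
    · rw [Finset.sum_add_distrib]
      congr 1
      · conv_lhs => rw [hs]
        exact Finset.sum_subset Finset.subset_union_left (fun j _ hj => hs0 j hj)
      · conv_lhs => rw [ht]
        exact Finset.sum_subset Finset.subset_union_right (fun j _ hj => ht0 j hj))

theorem cmp_mem {D : ℤ → AddSubgroup B} (h : IsGrd D) (a : B) (i : ℤ) : hcmp h i a ∈ D i :=
  cmpFun_mem h a i

theorem cmp_sum {D : ℤ → AddSubgroup B} (h : IsGrd D) (a : B) :
    ∃ s : Finset ℤ, (∀ i ∉ s, hcmp h i a = 0) ∧ a = ∑ i ∈ s, hcmp h i a := cmpFun_sum h a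

theorem cmp_eq {D : ℤ → AddSubgroup B} (h : IsGrd D) (a : B) (t : Finset ℤ) (g : ℤ → B)
    (hg : ∀ i, g i ∈ D i) (ha : a = ∑ i ∈ t, g i) (i : ℤ) :
    hcmp h i a = if i ∈ t then g i else 0 := by
  rw [← cmpFun_eq h a t g hg ha]
  rfl

theorem cmp_of_mem {D : ℤ → AddSubgroup B} (h : IsGrd D) {a : B} {i : ℤ} (ha : a ∈ D i) :
    hcmp h i a = a := by
  classical
  have := cmp_eq h a {i} (fun j => if j = i then a else 0)
    (by intro j; split_ifs with hj; · rwa [hj]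
        exact zero_mem _) (by simp) i
  simpa using this

/-- Compatibility of components with additive maps that shift the degree. -/
theorem cmp_map {D : ℤ → AddSubgroup B} {E : ℤ → AddSubgroup C} (h : IsGrd D) (k : IsGrd E)
    (f : B →+ C) (e : ℤ) (hf : ∀ i, ∀ b ∈ D i, f b ∈ E (i + e)) (b : B) (i : ℤ) :
    hcmp k i (f b) = f (hcmp h (i - e) b) := by
  classical
  obtain ⟨s, hs0, hs⟩ := cmp_sum h b
  refine cmpFun_eq' k _ (s.image (fun j => j + e)) (fun j => f (hcmp h (j - e) b)) ?_ ?_ ?_ i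
  · intro j
    have := hf (j - e) _ (cmp_mem h b (j - e))
    rwa [sub_add_cancel] at this
  · intro j hj
    rw [hs0 (j - e), map_zero]
    intro hj'
    exact hj (Finset.mem_image.2 ⟨_, hj', by ring⟩)
  · rw [Finset.sum_image (by intro a _ b _ hab; simpa using hab)]
    conv_lhs => rw [hs, map_sum]
    simp

end Components

section Helpers

theorem GWA.grd (G : GWA R σ v) : IsGrd G.deg := ⟨G.decomp, G.indep⟩

theorem GradedMod.grd (X : GradedMod G) : IsGrd X.deg := ⟨X.decomp, X.indep⟩

theorem cmp_smul (X : GradedMod G) {e : ℤ} {y : X.M} (hy : y ∈ X.deg e) (a : G.A) (i : ℤ) :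
    hcmp X.grd i (a • y) = hcmp G.grd (i - e) a • y := by
  have := cmp_map G.grd X.grd ((LinearMap.toSpanSingleton G.A X.M y).toAddMonoidHom) e
    (by intro i b hb; simpa using X.smul_mem hb hy) a i
  simpa using this

theorem cmp_mul_right {e : ℤ} {y : G.A} (hy : y ∈ G.deg e) (a : G.A) (i : ℤ) :
    hcmp G.grd i (a * y) = hcmp G.grd (i - e) a * y := by
  have := cmp_map G.grd G.grd (AddMonoidHom.mulRight y) e
    (by intro i b hb; simpa using G.mul_mem hb hy) a i
  simpa using this

theorem cmp_mul_left {e : ℤ} {y : G.A} (hy : y ∈ G.deg e) (a : G.A) (i : ℤ) :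
    hcmp G.grd i (y * a) = y * hcmp G.grd (i - e) a := by
  have := cmp_map G.grd G.grd (AddMonoidHom.mulLeft y) e
    (by intro i b hb; rw [add_comm]; simpa using G.mul_mem hy hb) a i
  simpa using this

theorem isGradedSub_of_cmp (X : GradedMod G) (N : Submodule G.A X.M)
    (h : ∀ m ∈ N, ∀ i, hcmp X.grd i m ∈ N) : IsGradedSub X N := by
  intro m hm
  obtain ⟨s, _, hs⟩ := cmp_sum X.grd m
  exact ⟨s, fun i => hcmp X.grd i m, fun i => cmp_mem _ _ _, h m hm, hs⟩

theorem IsGradedSub.cmp_mem {X : GradedMod G} {N : Submodule G.A X.M} (h : IsGradedSub X N)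
    {m : X.M} (hm : m ∈ N) (i : ℤ) : hcmp X.grd i m ∈ N := by
  obtain ⟨s, g, hg, hN, hs⟩ := h m hm
  rw [cmp_eq X.grd m s g hg hs]
  split_ifs
  · exact hN i
  · exact zero_mem _

theorem emb_mul_tm_pow (n : ℕ) (r : R) :
    G.emb ((σ ^ n) r) * G.tm ^ n = G.tm ^ n * G.emb r := by
  induction n generalizing r with
  | zero => simp
  | succ n ih =>
    have h1 : (σ ^ (n + 1)) r = (σ ^ n) (σ r) := by rw [pow_succ]; rfl
    rw [h1, pow_succ, ← mul_assoc, ih, mul_assoc, G.rel2, mul_assoc]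

theorem emb_mul_tm_pow' (n : ℕ) (r : R) :
    G.emb r * G.tm ^ n = G.tm ^ n * G.emb ((σ ^ (-(n : ℤ))) r) := by
  rw [← emb_mul_tm_pow, ← zpow_natCast, ← AlgEquiv.mul_apply, ← zpow_add]
  simp

theorem one_mem_deg (G : GWA R σ v) : (1 : G.A) ∈ G.deg 0 := by
  have := G.emb_mem 1
  rwa [map_one] at this

theorem tm_pow_mem (G : GWA R σ v) (n : ℕ) : G.tm ^ n ∈ G.deg (-(n : ℤ)) := by
  induction n with
  | zero => simpa using one_mem_deg G
  | succ n ih =>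
    have := G.mul_mem ih G.tm_mem
    rw [pow_succ]
    convert this using 2
    push_cast; ring

theorem emb_inj (G : GWA R σ v) {r s : R} (h : G.emb r = G.emb s) : r = s := by
  obtain ⟨t, _, ht⟩ := G.free_pos 0 (G.emb r) (by simpa using G.emb_mem r)
  rw [ht r (by simp), ht s (by simpa using h)]

theorem exists_emb (G : GWA R σ v) {a : G.A} (h : a ∈ G.deg 0) : ∃ r, a = G.emb r := by
  obtain ⟨t, ht, _⟩ := G.free_pos 0 a (by simpa using h)
  exact ⟨t, by simpa using ht⟩

/-- Twist of an ideal by a power of `σ`. -/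
def twist (σ : R ≃ₐ[ℂ] R) (I : Ideal R) (k : ℤ) : Ideal R :=
  I.comap ((σ ^ (-k) : R ≃ₐ[ℂ] R) : R →+* R)

theorem mem_twist {I : Ideal R} {k : ℤ} {r : R} : r ∈ twist σ I k ↔ (σ ^ (-k)) r ∈ I := Iff.rfl

theorem twist_twist (I : Ideal R) (k l : ℤ) : twist σ (twist σ I k) l = twist σ I (k + l) := by
  ext r
  rw [mem_twist, mem_twist, mem_twist, ← AlgEquiv.mul_apply, ← zpow_add, neg_add]

theorem twist_max {I : Ideal R} (h : I.IsMaximal) (k : ℤ) : (twist σ I k).IsMaximal :=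
  Ideal.comap_isMaximal_of_surjective _ (σ ^ (-k) : R ≃ₐ[ℂ] R).surjective

/-- The quotient of `A` by a graded left ideal, with a shifted grading. -/
def QuotGM (G : GWA R σ v) (I : Submodule G.A G.A) (hI : ∀ a ∈ I, ∀ i, hcmp G.grd i a ∈ I)
    (e : ℤ) : GradedMod G where
  M := G.A ⧸ I
  deg i := (G.deg (i - e)).map I.mkQ.toAddMonoidHom
  smul_mem := by
    rintro i j a _ ha ⟨m, hm, rfl⟩
    refine ⟨a * m, ?_, ?_⟩
    · have := G.mul_mem ha hm
      rwa [← add_sub_assoc] at this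
    · exact I.mkQ.map_smul a m
  decomp := by
    classical
    intro m
    obtain ⟨a, rfl⟩ := I.mkQ_surjective m
    obtain ⟨s, _, hs⟩ := cmp_sum G.grd a
    refine ⟨s.image (fun j => j + e), fun i => I.mkQ (hcmp G.grd (i - e) a), ?_, ?_⟩
    · intro i
      exact ⟨_, cmp_mem G.grd a _, rfl⟩
    · rw [Finset.sum_image (by intro a _ b _ hab; simpa using hab)]
      conv_lhs => rw [hs, map_sum]
      simp
  indep := by
    classical
    intro s g hg h0 i hi
    choose f hf1 hf2 using hg
    have h1 : (∑ j ∈ s, f j) ∈ I := by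
      rw [← Submodule.ker_mkQ I, LinearMap.mem_ker, map_sum, ← h0]
      exact Finset.sum_congr rfl (fun j _ => hf2 j)
    have h2 := hI _ h1 (i - e)
    have h3 := cmp_eq G.grd (∑ j ∈ s, f j) (s.image (fun j => j - e)) (fun j => f (j + e))
      (by intro j; simpa using hf1 (j + e))
      (by
        rw [Finset.sum_image (by intro a _ b _ hab; simpa using hab)]
        simp) (i - e)
    rw [if_pos (Finset.mem_image_of_mem _ hi), sub_add_cancel] at h3
    rw [h3] at h2
    rw [← hf2 i]
    exact (Submodule.Quotient.mk_eq_zero I).2 h2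

/-- The left ideal of `A` such that `A/I` is the simple graded module attached to `μ`. -/
def simI (G : GWA R σ v) (mu : Ideal R) : Submodule G.A G.A where
  carrier := {a | ∀ b : G.A, ∃ r ∈ mu, hcmp G.grd 0 (b * a) = G.emb r}
  zero_mem' := fun b => ⟨0, zero_mem _, by simp⟩
  add_mem' := by
    intro a a' ha ha' b
    obtain ⟨r, hr, h⟩ := ha b
    obtain ⟨r', hr', h'⟩ := ha' b
    exact ⟨r + r', add_mem hr hr', by rw [mul_add, map_add, h, h', map_add]⟩
  smul_mem' := by
    intro c a ha b
    obtain ⟨r, hr, h⟩ := ha (b * c)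
    exact ⟨r, hr, by rw [smul_eq_mul, ← mul_assoc, h]⟩

theorem mem_simI {mu : Ideal R} {a : G.A} :
    a ∈ simI G mu ↔ ∀ b : G.A, ∃ r ∈ mu, hcmp G.grd 0 (b * a) = G.emb r := Iff.rfl

theorem simI_grd (mu : Ideal R) : ∀ a ∈ simI G mu, ∀ i, hcmp G.grd i a ∈ simI G mu := by
  intro a ha i b
  obtain ⟨r, hr, h⟩ := ha (hcmp G.grd (0 - i) b)
  refine ⟨r, hr, ?_⟩
  rw [← h, cmp_mul_right (cmp_mem G.grd a i), cmp_mul_left (cmp_mem G.grd b (0 - i))]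
  congr 2
  ring_nf

theorem emb_mem_simI {mu : Ideal R} {s : R} (hs : s ∈ mu) : G.emb s ∈ simI G mu := by
  intro b
  rw [cmp_mul_right (G.emb_mem s), sub_zero]
  obtain ⟨r, hr⟩ := exists_emb G (cmp_mem G.grd b 0)
  exact ⟨r * s, mu.mul_mem_left r hs, by rw [hr, map_mul]⟩

/-- The simple module. -/
def simM (G : GWA R σ v) (mu : Ideal R) (e : ℤ) : GradedMod G :=
  QuotGM G (simI G mu) (simI_grd mu) e

theorem max_inv {mu : Ideal R} (hmu : mu.IsMaximal) {r : R} (hr : r ∉ mu) :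
    ∃ u, u * r - 1 ∈ mu := by
  obtain ⟨u, i, hi, h⟩ := hmu.exists_inv hr
  refine ⟨u, ?_⟩
  have : u * r - 1 = -i := by rw [← h]; ring
  rw [this]
  exact neg_mem hi

theorem simM_simple {mu : Ideal R} (hmu : mu.IsMaximal) (e : ℤ) : IsSimpleGr (simM G mu e) := by
  refine ⟨⟨(simI G mu).mkQ 1, ?_⟩, ?_⟩
  · intro h
    have h1 : (1 : G.A) ∈ simI G mu := (Submodule.Quotient.mk_eq_zero _).1 h
    obtain ⟨r, hr, h2⟩ := h1 1
    rw [mul_one, cmp_of_mem G.grd (one_mem_deg G), ← map_one G.emb] at h2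
    rw [← emb_inj G h2] at hr
    exact hmu.ne_top ((Ideal.eq_top_iff_one _).2 hr)
  · intro N hN
    rw [or_iff_not_imp_left]
    intro hne
    obtain ⟨m, hm, hm0⟩ := (Submodule.ne_bot_iff N).1 hne
    obtain ⟨s, g, hg, hgN, hs⟩ := hN m hm
    have : ∃ i ∈ s, g i ≠ 0 := by
      by_contra hcon
      push Not at hcon
      exact hm0 (by rw [hs]; exact Finset.sum_eq_zero hcon)
    obtain ⟨i, -, hi⟩ := this
    obtain ⟨a, ha, hai⟩ := hg i
    have haI : a ∉ simI G mu := by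
      intro h
      apply hi
      rw [← hai]
      exact (Submodule.Quotient.mk_eq_zero _).2 h
    rw [mem_simI] at haI
    push Not at haI
    obtain ⟨b, hb⟩ := haI
    obtain ⟨r, hr⟩ := exists_emb G (cmp_mem G.grd (b * a) 0)
    have hrmu : r ∉ mu := fun h => hb r h hr
    rw [cmp_mul_right ha] at hr
    obtain ⟨u, hu⟩ := max_inv hmu hrmu
    have h1 : (simI G mu).mkQ (G.emb (u * r)) ∈ N := by
      rw [map_mul, ← hr, ← smul_eq_mul, map_smul, ← smul_eq_mul, map_smul]
      apply N.smul_mem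
      apply N.smul_mem
      have := hgN i
      rw [← hai] at this
      exact this
    have h2 : (simI G mu).mkQ (G.emb (u * r)) = (simI G mu).mkQ 1 := by
      rw [← sub_eq_zero, ← map_sub, ← map_one G.emb, ← map_sub]
      exact (Submodule.Quotient.mk_eq_zero _).2 (emb_mem_simI hu)
    rw [h2] at h1
    rw [eq_top_iff]
    rintro x -
    obtain ⟨c, rfl⟩ := (simI G mu).mkQ_surjective x
    have := N.smul_mem c h1
    have h3 : c • (simI G mu).mkQ (1 : G.A) = (simI G mu).mkQ c := by
      rw [← map_smul, smul_eq_mul, mul_one]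
    rw [← h3]
    exact this

theorem tp_tm_pow {mu : Ideal R} (hmu : mu.IsMaximal)
    (hv : ∀ n : ℕ, (σ ^ (-(n : ℤ))) v ∉ mu) (n : ℕ) :
    ∃ p ∉ mu, G.tp ^ n * G.tm ^ n = G.emb p := by
  induction n with
  | zero =>
    exact ⟨1, fun h => hmu.ne_top ((Ideal.eq_top_iff_one _).2 h), by simp⟩
  | succ n ih =>
    obtain ⟨p, hp, h⟩ := ih
    refine ⟨p * (σ ^ (-(n : ℤ))) v, fun hh => ?_, ?_⟩
    · rcases hmu.isPrime.mem_or_mem hh with h1 | h1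
      · exact hp h1
      · exact hv n h1
    · rw [map_mul, ← h, pow_succ, pow_succ' G.tm, mul_assoc, mul_assoc, ← emb_mul_tm_pow',
        ← G.rel4]
      simp only [mul_assoc]

theorem simM_unbdd {mu : Ideal R} (hmu : mu.IsMaximal)
    (hv : ∀ n : ℕ, (σ ^ (-(n : ℤ))) v ∉ mu) (e : ℤ) :
    ∀ N : ℤ, ∃ i : ℤ, i ≤ N ∧ (simM G mu e).deg i ≠ ⊥ := by
  intro N
  obtain ⟨n, hn⟩ : ∃ n : ℕ, e - n ≤ N := ⟨(e - N).toNat, by have := Int.self_le_toNat (e - N); lia⟩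
  refine ⟨e - n, hn, fun hbot => ?_⟩
  have h1 : (simI G mu).mkQ (G.tm ^ n) ∈ (simM G mu e).deg (e - n) := by
    refine ⟨G.tm ^ n, ?_, rfl⟩
    have := tm_pow_mem G n
    have h2 : e - (n : ℤ) - e = -(n : ℤ) := by ring
    rw [h2]
    exact this
  rw [hbot] at h1
  have h2 : G.tm ^ n ∈ simI G mu := (Submodule.Quotient.mk_eq_zero _).1 ((AddSubgroup.mem_bot).1 h1)
  obtain ⟨r, hr, h3⟩ := h2 (G.tp ^ n)
  obtain ⟨p, hp, h4⟩ := tp_tm_pow (G := G) hmu hv n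
  rw [h4, cmp_of_mem G.grd (G.emb_mem p)] at h3
  rw [emb_inj G h3] at hp
  exact hp hr

theorem simM_subquot (X : GradedMod G) {mu : Ideal R} {e : ℤ} {y : X.M} (hy : y ∈ X.deg e)
    (hann : ∀ r : R, G.emb r • y = 0 → r ∈ mu) : IsSubquotient X (simM G mu e) := by
  set f := LinearMap.toSpanSingleton G.A X.M y with hf
  have hfa : ∀ a, f a = a • y := fun a => by simp [hf]
  have hker : LinearMap.ker f ≤ LinearMap.ker (simI G mu).mkQ := by
    intro a ha
    rw [Submodule.ker_mkQ]
    rw [LinearMap.mem_ker, hfa] at ha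
    intro b
    obtain ⟨r, hr⟩ := exists_emb G (cmp_mem G.grd (b * a) 0)
    refine ⟨r, hann r ?_, hr⟩
    have h1 := cmp_smul X hy (b * a) e
    rw [sub_self, hr, mul_smul, ha, smul_zero, map_zero] at h1
    exact h1.symm
  let φ : LinearMap.range f →ₗ[G.A] (G.A ⧸ simI G mu) :=
    (Submodule.liftQ (LinearMap.ker f) (simI G mu).mkQ hker) ∘ₗ
      f.quotKerEquivRange.symm.toLinearMap
  have hφ : ∀ (a : G.A) (h : f a ∈ LinearMap.range f), φ ⟨f a, h⟩ = (simI G mu).mkQ a := by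
    intro a h
    have h1 : f.quotKerEquivRange.symm ⟨f a, h⟩ = Submodule.Quotient.mk a := by
      rw [LinearEquiv.symm_apply_eq]
      apply Subtype.ext
      simp [LinearMap.quotKerEquivRange_apply_mk]
    simp only [φ, LinearMap.comp_apply, LinearEquiv.coe_coe, h1]
    rfl
  refine ⟨LinearMap.range f, (simI G mu).map f, ?_, ?_, ?_, φ, ?_, ?_, ?_⟩
  · apply isGradedSub_of_cmp
    rintro _ ⟨a, rfl⟩ i
    rw [hfa, cmp_smul X hy, ← hfa]
    exact ⟨_, rfl⟩
  · apply isGradedSub_of_cmp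
    rintro _ ⟨a, ha, rfl⟩ i
    rw [hfa, cmp_smul X hy, ← hfa]
    exact ⟨_, simI_grd mu a ha _, rfl⟩
  · exact LinearMap.map_le_range
  · intro x
    obtain ⟨a, rfl⟩ := (simI G mu).mkQ_surjective x
    exact ⟨⟨f a, ⟨a, rfl⟩⟩, hφ a _⟩
  · rintro ⟨_, ⟨a, rfl⟩⟩
    suffices hh : (simI G mu).mkQ a = 0 ↔ f a ∈ (simI G mu).map f by
      rw [← hφ a ⟨a, rfl⟩] at hh
      exact hh
    constructor
    · intro h
      exact ⟨a, (Submodule.Quotient.mk_eq_zero _).1 h, rfl⟩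
    · rintro ⟨b, hb, hba⟩
      have h1 : (simI G mu).mkQ (b - a) = 0 := by
        apply hker
        rw [LinearMap.mem_ker, map_sub, hba, sub_self]
      have h2 : (simI G mu).mkQ b = 0 := (Submodule.Quotient.mk_eq_zero _).2 hb
      rw [map_sub, h2, zero_sub, neg_eq_zero] at h1
      exact h1
  · rintro i ⟨_, ⟨a, rfl⟩⟩ hi
    dsimp only at hi
    have h1 : f (hcmp G.grd (i - e) a) = f a := by
      rw [hfa, ← cmp_smul X hy, ← hfa, cmp_of_mem X.grd hi]
    refine ⟨hcmp G.grd (i - e) a, cmp_mem _ _ _, ?_⟩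
    have h2 := hφ (hcmp G.grd (i - e) a) ⟨_, rfl⟩
    have h3 : (⟨f a, ⟨a, rfl⟩⟩ : LinearMap.range f) = ⟨f (hcmp G.grd (i - e) a), ⟨_, rfl⟩⟩ :=
      Subtype.ext h1.symm
    rw [← h3] at h2
    exact h2.symm

theorem std_grd (lam : Ideal R) : ∀ a ∈ Submodule.span G.A (G.emb '' (lam : Set R)),
    ∀ i, hcmp G.grd i a ∈ Submodule.span G.A (G.emb '' (lam : Set R)) := by
  intro a ha i
  suffices h : ∀ b, ∀ i, hcmp G.grd i (b * a) ∈ Submodule.span G.A (G.emb '' (lam : Set R)) by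
    simpa using h 1 i
  clear i
  induction ha using Submodule.span_induction with
  | mem x hx =>
    obtain ⟨s, hs, rfl⟩ := hx
    intro b i
    rw [cmp_mul_right (G.emb_mem s)]
    exact Submodule.smul_mem _ _ (Submodule.subset_span ⟨s, hs, rfl⟩)
  | zero => simp
  | add x y _ _ hx hy =>
    intro b i
    rw [mul_add, map_add]
    exact add_mem (hx b i) (hy b i)
  | smul c x _ hx =>
    intro b i
    rw [smul_eq_mul, ← mul_assoc]
    exact hx _ i

/-- `A/Aλ`. -/
def stdM (G : GWA R σ v) (lam : Ideal R) : GradedMod G := QuotGM G _ (std_grd lam) 0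

theorem stdM_std (lam : Ideal R) : IsStdMod G lam (stdM G lam) := by
  set I := Submodule.span G.A (G.emb '' (lam : Set R)) with hI
  have key : ∀ c : G.A, c • I.mkQ (1 : G.A) = I.mkQ c := by
    intro c
    rw [← map_smul, smul_eq_mul, mul_one]
  refine ⟨I.mkQ 1, ⟨1, by simpa using one_mem_deg G, rfl⟩, ?_, ?_⟩
  · rw [eq_top_iff]
    rintro x -
    obtain ⟨c, rfl⟩ := I.mkQ_surjective x
    exact Submodule.mem_span_singleton.2 ⟨c, key c⟩
  · intro a
    have h1 : I.mkQ a = 0 ↔ a ∈ I := Submodule.Quotient.mk_eq_zero _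
    rw [← key a] at h1
    exact h1

theorem std_ann (lam : Ideal R) (n : ℕ) (r : R)
    (h : G.emb r * G.tm ^ n ∈ Submodule.span G.A (G.emb '' (lam : Set R))) :
    r ∈ twist σ lam n := by
  have key : ∀ a ∈ Submodule.span G.A (G.emb '' (lam : Set R)), ∀ b : G.A,
      ∃ r ∈ twist σ lam n, hcmp G.grd (-(n : ℤ)) (b * a) = G.emb r * G.tm ^ n := by
    intro a ha
    induction ha using Submodule.span_induction with
    | mem x hx =>
      obtain ⟨s, hs, rfl⟩ := hx
      intro b
      obtain ⟨q, hq, -⟩ := G.free_neg n (hcmp G.grd (-(n : ℤ)) b) (cmp_mem _ _ _)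
      refine ⟨q * (σ ^ n) s, Ideal.mul_mem_left _ _ ?_, ?_⟩
      · rw [mem_twist, ← zpow_natCast, ← AlgEquiv.mul_apply, ← zpow_add]
        simpa using hs
      · rw [cmp_mul_right (G.emb_mem s), sub_zero, hq, map_mul, mul_assoc, mul_assoc,
          emb_mul_tm_pow]
    | zero => exact fun b => ⟨0, zero_mem _, by simp⟩
    | add x y _ _ hx hy =>
      intro b
      obtain ⟨r, hr, h⟩ := hx b
      obtain ⟨r', hr', h'⟩ := hy b
      exact ⟨r + r', add_mem hr hr', by rw [mul_add, map_add, h, h', map_add, add_mul]⟩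
    | smul c x _ hx =>
      intro b
      rw [smul_eq_mul, ← mul_assoc]
      exact hx _
  obtain ⟨r', hr', h'⟩ := key _ h 1
  have hm : G.emb r * G.tm ^ n ∈ G.deg (-(n : ℤ)) := by
    simpa using G.mul_mem (G.emb_mem r) (tm_pow_mem G n)
  rw [one_mul, cmp_of_mem G.grd hm] at h'
  rwa [(G.free_neg n _ hm).unique rfl h']

theorem star_bdd (hstar : StarCond σ v) {lam : Ideal R} (hlam : lam.IsMaximal) :
    ∃ K : ℤ, ∀ k : ℤ, k ≤ K → (σ ^ k) v ∉ lam := by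
  by_cases hne : ∃ a : ℤ, (σ ^ a) v ∈ lam
  · obtain ⟨a, ha⟩ := hne
    let p : PrimeSpectrum R := ⟨twist σ lam (-a), (twist_max hlam _).isPrime⟩
    have hp : p ∈ ZLocus R v := by
      rw [ZLocus, PrimeSpectrum.mem_zeroLocus, Set.singleton_subset_iff]
      change v ∈ twist σ lam (-a)
      rw [mem_twist, neg_neg]
      exact ha
    obtain ⟨-, N, hN⟩ := hstar _ ⟨p, hp, rfl⟩
    refine ⟨a - N, fun k hk hmem => ?_⟩
    have h1 := hN (a - k) (by lia)
    have h2 : p ∈ connectedComponentIn (ZLocus R v) p ∩ (XiMap σ (a - k) '' ZLocus R v) := by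
      refine ⟨mem_connectedComponentIn hp,
        ⟨twist σ lam (-k), (twist_max hlam _).isPrime⟩, ?_, ?_⟩
      · rw [ZLocus, PrimeSpectrum.mem_zeroLocus, Set.singleton_subset_iff]
        change v ∈ twist σ lam (-k)
        rw [mem_twist, neg_neg]
        exact hmem
      · apply PrimeSpectrum.ext
        ext r
        change (σ ^ (a - k)) r ∈ twist σ lam (-k) ↔ r ∈ twist σ lam (-a)
        rw [mem_twist, mem_twist, ← AlgEquiv.mul_apply, ← zpow_add]
        have h3 : - -k + (a - k) = - -a := by ring
        rw [h3]
    rw [h1] at h2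
    exact h2
  · push Not at hne
    exact ⟨0, fun k _ => hne k⟩

theorem smul_tm_nil (X : GradedMod G) (c : R) (k : ℕ) (m : X.M) (h : G.tm ^ k • m = 0) :
    G.tm ^ k • G.emb c • m = 0 := by
  rw [← mul_smul, ← emb_mul_tm_pow, mul_smul, h, smul_zero]

theorem tm_mono (X : GradedMod G) {k l : ℕ} (hkl : k ≤ l) {m : X.M} (h : G.tm ^ k • m = 0) :
    G.tm ^ l • m = 0 := by
  obtain ⟨j, rfl⟩ := Nat.exists_eq_add_of_le' hkl
  rw [pow_add, mul_smul, h, smul_zero]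

/-- The union of the annihilators. -/
def nilJ (X : GradedMod G) (m : X.M) : Ideal R where
  carrier := {r | ∃ k : ℕ, G.tm ^ k • G.emb r • m = 0}
  zero_mem' := ⟨0, by simp⟩
  add_mem' := by
    rintro a b ⟨k, hk⟩ ⟨l, hl⟩
    refine ⟨max k l, ?_⟩
    rw [map_add, add_smul, smul_add, tm_mono X (le_max_left k l) hk,
      tm_mono X (le_max_right k l) hl, add_zero]
  smul_mem' := by
    rintro c a ⟨k, hk⟩
    refine ⟨k, ?_⟩
    rw [smul_eq_mul, map_mul, mul_smul]
    exact smul_tm_nil X c k _ hk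

theorem exists_homog (X : GradedMod G) (h : ¬ InOPlus G X) :
    ∃ (d : ℤ) (m : X.M), m ∈ X.deg d ∧ ∀ k : ℕ, G.tm ^ k • m ≠ 0 := by
  by_contra hcon
  push Not at hcon
  apply h
  intro m
  obtain ⟨s, -, hs⟩ := cmp_sum X.grd m
  choose k hk using fun i => hcon i _ (cmp_mem X.grd m i)
  refine ⟨s.sup k, ?_⟩
  rw [hs, Finset.smul_sum]
  exact Finset.sum_eq_zero (fun i hi => tm_mono X (Finset.le_sup hi) (hk i))

theorem backward (hstar : StarCond σ v) (X : GradedMod G) (h : ¬ InOPlus G X) :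
    ∃ S : GradedMod G, IsSubquotient X S ∧
        ∃ lam : Ideal R, lam.IsMaximal ∧ IsALamMinus G lam S := by
  obtain ⟨d, m, hm, hnz⟩ := exists_homog X h
  have hJ : nilJ X m ≠ ⊤ := by
    rw [Ne, Ideal.eq_top_iff_one]
    rintro ⟨k, hk⟩
    rw [map_one, one_smul] at hk
    exact hnz k hk
  obtain ⟨lam, hlam, hle⟩ := Ideal.exists_le_maximal _ hJ
  obtain ⟨K, hK⟩ := star_bdd hstar hlam
  obtain ⟨n, k, hkK, hnk⟩ : ∃ n k : ℕ, -(k : ℤ) ≤ K ∧ d + n = k := by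
    refine ⟨(-K).toNat + (-d).toNat + d.toNat - d.toNat + (-K - d).toNat,
      (d + ((-K).toNat + (-d).toNat + d.toNat - d.toNat + (-K - d).toNat : ℕ)).toNat, ?_, ?_⟩ <;> lia
  have hmu : (twist σ lam k).IsMaximal := twist_max hlam k
  have hv : ∀ n : ℕ, (σ ^ (-(n : ℤ))) v ∉ twist σ lam k := by
    intro j
    rw [mem_twist, ← AlgEquiv.mul_apply, ← zpow_add]
    exact hK _ (by lia)
  refine ⟨simM G (twist σ lam k) (d - k), ?_, twist σ lam d, twist_max hlam d,
    stdM G (twist σ lam d), stdM_std _, ?_, simM_simple hmu _, simM_unbdd hmu hv _⟩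
  · refine simM_subquot X (y := G.tm ^ k • m) ?_ ?_
    · have := X.smul_mem (tm_pow_mem G k) hm
      rwa [neg_add_eq_sub] at this
    · intro r hr
      rw [← mul_smul, emb_mul_tm_pow', mul_smul] at hr
      exact hle ⟨k, hr⟩
  · refine simM_subquot (stdM G (twist σ lam d))
      (y := (Submodule.span G.A (G.emb '' (twist σ lam d : Set R))).mkQ (G.tm ^ n)) ?_ ?_
    · refine ⟨G.tm ^ n, ?_, rfl⟩
      have h1 : d - (k : ℤ) - 0 = -(n : ℤ) := by lia
      rw [h1]
      exact tm_pow_mem G n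
    · intro r hr
      have h1 : G.emb r * G.tm ^ n ∈ Submodule.span G.A (G.emb '' (twist σ lam d : Set R)) :=
        (Submodule.Quotient.mk_eq_zero _).1 hr
      have h2 := std_ann _ n r h1
      rwa [twist_twist, hnk] at h2

theorem forward (X : GradedMod G) (h : InOPlus G X) (S : GradedMod G) (hS : IsSubquotient X S)
    (lam : Ideal R) (hlam : lam.IsMaximal) (hA : IsALamMinus G lam S) : False := by
  have hSO : InOPlus G S := by
    obtain ⟨Q, P, -, -, -, φ, hsurj, -, -⟩ := hS
    intro s
    obtain ⟨q, rfl⟩ := hsurj s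
    obtain ⟨k, hk⟩ := h q
    refine ⟨k, ?_⟩
    rw [← map_smul]
    have : G.tm ^ k • q = 0 := Subtype.ext hk
    rw [this, map_zero]
  obtain ⟨Y, ⟨x, hx, hspan, hann⟩, ⟨Q, P, hQ, hP, hPQ, φ, hsurj, hker, hdeg⟩, -, hunb⟩ := hA
  have hlift : ∀ (n : ℕ), S.deg (-(n : ℤ)) ≠ ⊥ →
      G.tm ^ n • x ∈ Q ∧ G.tm ^ n • x ∉ P := by
    intro n hn
    obtain ⟨s, hs, hs0⟩ : ∃ s : S.M, s ∈ S.deg (-(n : ℤ)) ∧ s ≠ 0 := by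
      obtain ⟨s, hs⟩ := AddSubgroup.ne_bot_iff_exists_ne_zero.1 hn
      exact ⟨s, s.2, fun h => hs (Subtype.ext h)⟩
    obtain ⟨q, hq⟩ := hsurj s
    obtain ⟨t, g, hg, hgQ, ht⟩ := hQ q q.2
    have h1 : (s : S.M) = ∑ i ∈ t, φ ⟨g i, hgQ i⟩ := by
      rw [← hq, ← map_sum]
      congr 1
      apply Subtype.ext
      rw [Submodule.coe_sum]
      exact ht
    have h2 := cmp_eq S.grd s t (fun i => φ ⟨g i, hgQ i⟩) (fun i => hdeg i _ (hg i)) h1 (-(n : ℤ))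
    rw [cmp_of_mem S.grd hs] at h2
    have h3 : φ ⟨g (-(n : ℤ)), hgQ _⟩ ≠ 0 := by
      intro h4
      rw [h4, ite_self] at h2
      exact hs0 h2
    rw [Ne, hker] at h3
    dsimp only at h3
    have hgq := hgQ (-(n : ℤ))
    have hgd := hg (-(n : ℤ))
    obtain ⟨a, ha⟩ := Submodule.mem_span_singleton.1
      (hspan ▸ Submodule.mem_top : g (-(n : ℤ)) ∈ Submodule.span G.A {x})
    have h5 := cmp_smul Y hx a (-(n : ℤ))
    rw [ha, cmp_of_mem Y.grd hgd, sub_zero] at h5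
    obtain ⟨r, hr, -⟩ := G.free_neg n _ (cmp_mem G.grd a (-(n : ℤ)))
    rw [hr] at h5
    have h6 : G.tm ^ n • x ∉ P := by
      intro h7
      apply h3
      rw [h5, mul_smul]
      exact P.smul_mem _ h7
    refine ⟨?_, h6⟩
    rw [emb_mul_tm_pow'] at h5
    set r' := (σ ^ (-(n : ℤ))) r with hr'
    have hr'lam : r' ∉ lam := by
      intro h7
      apply h3
      have : G.emb r' • x = 0 := (hann _).2 (Submodule.subset_span ⟨r', h7, rfl⟩)
      rw [h5, mul_smul, this, smul_zero]
      exact zero_mem _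
    obtain ⟨u, hu⟩ := max_inv hlam hr'lam
    have h8 : G.emb (u * r' - 1) • x = 0 := (hann _).2 (Submodule.subset_span ⟨_, hu, rfl⟩)
    rw [map_sub, map_one, sub_smul, one_smul, sub_eq_zero] at h8
    have h9 : G.tm ^ n • x = G.emb ((σ ^ n) u) • g (-(n : ℤ)) := by
      rw [h5, ← mul_smul, ← mul_assoc, emb_mul_tm_pow, mul_assoc, ← map_mul, mul_smul, h8]
    rw [h9]
    exact Q.smul_mem _ hgq
  obtain ⟨i, hi0, hi⟩ := hunb 0
  obtain ⟨n, rfl⟩ : ∃ n : ℕ, i = -(n : ℤ) := ⟨(-i).toNat, by lia⟩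
  obtain ⟨hnQ, -⟩ := hlift n hi
  obtain ⟨k, hk⟩ := hSO (φ ⟨_, hnQ⟩)
  rw [← map_smul, hker] at hk
  change G.tm ^ k • G.tm ^ n • x ∈ P at hk
  obtain ⟨j, hj0, hj⟩ := hunb (-((k + n : ℕ) : ℤ))
  obtain ⟨l, rfl⟩ : ∃ l : ℕ, j = -((l + (k + n) : ℕ) : ℤ) :=
    ⟨(-j - (k + n : ℕ)).toNat, by lia⟩
  obtain ⟨-, hnP⟩ := hlift _ hj
  apply hnP
  rw [pow_add, pow_add, mul_smul, mul_smul]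
  exact P.smul_mem _ hk

end Helpers

/-- Assume (*). A graded module belongs to `O⁺` iff it has no graded
subquotient isomorphic to `A^{λ,−}` for any maximal ideal `λ`. -/
theorem stmt16 {R : Type} [CommRing R] [Algebra ℂ R] (hfg : Algebra.FiniteType ℂ R)
    {σ : R ≃ₐ[ℂ] R} {v : R} (G : GWA R σ v) (hstar : StarCond σ v)
    (M : GradedMod G) :
    InOPlus G M ↔
      ¬ ∃ S : GradedMod G, IsSubquotient M S ∧
        ∃ lam : Ideal R, lam.IsMaximal ∧ IsALamMinus G lam S := by
  constructor
  · rintro h ⟨S, hS, lam, hlam, hA⟩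
    exact forward M h S hS lam hlam hA
  · intro h
    by_contra hcon
    exact h (backward hstar M hcon)
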